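/- Suppose U* ∈ ℝ^{m×k} has orthonormal columns and is incoherent with parameter μ (i.e., every row of U* has ℓ₂-norm at most μ√k/√m), and U ∈ ℝ^{m×k} has orthonormal columns with dist(U, U*) ≤ 1/(64k). Let U^c be obtained from U by setting to zero all entries of magnitude greater than 2μ√k/√m, and let Ũ be an orthonormal basis of the column span of U^c. Then dist(Ũ, U*) ≤ 1/2, and Ũ is incoherent with parameter 4μ√k. -/

import Mathlib

open Matrix MeasureTheory Finset

noncomputable section

namespace AltMin

/-- Euclidean norm of a finitely-indexed real vector. -/
def euclNorm {ι : Type*} [Fintype ι] (v : ι → ℝ) : ℝ :=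
  Real.sqrt (∑ i, v i ^ 2)

/-- Frobenius norm of a real matrix. -/
def frobNorm {ι κ : Type*} [Fintype ι] [Fintype κ] (A : Matrix ι κ ℝ) : ℝ :=
  Real.sqrt (∑ i, ∑ j, A i j ^ 2)

/-- Spectral norm of a real matrix. -/
def specNorm {ι κ : Type*} [Fintype ι] [Fintype κ] (A : Matrix ι κ ℝ) : ℝ :=
  sSup {r : ℝ | ∃ v : κ → ℝ, euclNorm v = 1 ∧ r = euclNorm (A.mulVec v)}

/-- Minimum singular value of a square real matrix. -/
def minSingVal {ι : Type*} [Fintype ι] (A : Matrix ι ι ℝ) : ℝ :=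
  sInf {r : ℝ | ∃ v : ι → ℝ, euclNorm v = 1 ∧ r = euclNorm (A.mulVec v)}

/-- Orthogonal projection onto the column span of a (full column rank) matrix. -/
def colProj {m k : ℕ} (W : Matrix (Fin m) (Fin k) ℝ) : Matrix (Fin m) (Fin m) ℝ :=
  W * (Wᵀ * W)⁻¹ * Wᵀ

/-- Principal-angle distance `dist(W₁, W₂) = ‖(W₁⊥)ᵀ W₂‖₂` between column spans,
expressed basis-independently via orthogonal projections. -/
def matDist {m k₁ k₂ : ℕ} (W₁ : Matrix (Fin m) (Fin k₁) ℝ)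
    (W₂ : Matrix (Fin m) (Fin k₂) ℝ) : ℝ :=
  specNorm ((1 - colProj W₁) * colProj W₂)

/-- The linear measurement operator `𝒜(X)ᵢ = tr(Aᵢᵀ X)`. -/
def sense {m n d : ℕ} (A : Fin d → Matrix (Fin m) (Fin n) ℝ)
    (X : Matrix (Fin m) (Fin n) ℝ) : Fin d → ℝ :=
  fun i => ((A i)ᵀ * X).trace

/-- The adjoint `𝒜ᵀ(y) = ∑ i, yᵢ Aᵢ` of the measurement operator. -/
def senseAdj {m n d : ℕ} (A : Fin d → Matrix (Fin m) (Fin n) ℝ) (y : Fin d → ℝ) :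
    Matrix (Fin m) (Fin n) ℝ :=
  ∑ i, y i • A i

/-- `k`-restricted isometry property with constant `δ`. -/
def RIP {m n d : ℕ} (A : Fin d → Matrix (Fin m) (Fin n) ℝ) (k : ℕ) (δ : ℝ) : Prop :=
  ∀ X : Matrix (Fin m) (Fin n) ℝ, X.rank ≤ k →
    (1 - δ) * frobNorm X ^ 2 ≤ euclNorm (sense A X) ^ 2 ∧
      euclNorm (sense A X) ^ 2 ≤ (1 + δ) * frobNorm X ^ 2

/-- `U` consists of top-`k` left singular vectors of `Y`:  `U` has orthonormal columns and
maximizes `‖U'ᵀ Y‖_F` over all matrices with orthonormal columns. -/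
def IsTopKLeftSing {m n k : ℕ} (Y : Matrix (Fin m) (Fin n) ℝ)
    (U : Matrix (Fin m) (Fin k) ℝ) : Prop :=
  Uᵀ * U = 1 ∧ ∀ U' : Matrix (Fin m) (Fin k) ℝ, U'ᵀ * U' = 1 →
    frobNorm (U'ᵀ * Y) ≤ frobNorm (Uᵀ * Y)

/-- `Z` is a best rank-`i` approximation of `Y` in Frobenius norm
(the top-`i` singular components of `Y`). -/
def IsBestRankApprox {m n : ℕ} (Y Z : Matrix (Fin m) (Fin n) ℝ) (i : ℕ) : Prop :=
  Z.rank ≤ i ∧ ∀ W : Matrix (Fin m) (Fin n) ℝ, W.rank ≤ i →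
    frobNorm (Y - Z) ≤ frobNorm (Y - W)

/-- `P_Ω`: keep the entries in `Ω`, zero out the rest. -/
def projO {m n : ℕ} (Ω : Set (Fin m × Fin n)) (X : Matrix (Fin m) (Fin n) ℝ) :
    Matrix (Fin m) (Fin n) ℝ :=
  fun i j => Set.indicator Ω (fun _ => X i j) (i, j)

/-- Clip to zero all entries of magnitude greater than `θ`. -/
def clip {m k : ℕ} (θ : ℝ) (W : Matrix (Fin m) (Fin k) ℝ) : Matrix (Fin m) (Fin k) ℝ :=
  fun i j => if θ < |W i j| then 0 else W i j

/-- Bernoulli measure with parameter `p` on `Bool`. -/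
def bernoulliMeasure (p : ℝ) : Measure Bool :=
  ENNReal.ofReal p • Measure.dirac true + ENNReal.ofReal (1 - p) • Measure.dirac false

/-- Each entry of an `m × n` matrix is observed independently with probability `p`. -/
def sampleMeasure (m n : ℕ) (p : ℝ) : Measure ((Fin m × Fin n) → Bool) :=
  Measure.pi fun _ => bernoulliMeasure p

instance optionMeasurableSpace {α : Type*} : MeasurableSpace (Option α) := ⊤

/-- Each entry is (independently) unobserved with probability `1 - p`, and observed and
assigned to one of `K` buckets uniformly otherwise. -/
def partMeasure (K : ℕ) (p : ℝ) : Measure (Option (Fin K)) :=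
  ENNReal.ofReal (1 - p) • Measure.dirac none +
    ∑ t : Fin K, ENNReal.ofReal (p / K) • Measure.dirac (some t)

/-- Product sampling measure for the partitioned-observation model. -/
def partSampleMeasure (m n K : ℕ) (p : ℝ) : Measure ((Fin m × Fin n) → Option (Fin K)) :=
  Measure.pi fun _ => partMeasure K p

/-- The `j`-th bucket of observed entries. -/
def partSet {m n K : ℕ} (ω : Fin m × Fin n → Option (Fin K)) (j : ℕ) :
    Set (Fin m × Fin n) :=
  {q | Option.map Fin.val (ω q) = some j}

end AltMin

namespace AltMin

theorem euclNorm_eq_norm {ι : Type*} [Fintype ι] (v : ι → ℝ) :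
    euclNorm v = ‖WithLp.toLp 2 v‖ := by
  simp [euclNorm, EuclideanSpace.norm_eq]

theorem euclNorm_nonneg {ι : Type*} [Fintype ι] (v : ι → ℝ) : 0 ≤ euclNorm v :=
  Real.sqrt_nonneg _

theorem euclNorm_sq {ι : Type*} [Fintype ι] (v : ι → ℝ) : euclNorm v ^ 2 = v ⬝ᵥ v := by
  rw [euclNorm, Real.sq_sqrt (by positivity)]
  simp [dotProduct, sq]

theorem euclNorm_add_le {ι : Type*} [Fintype ι] (v w : ι → ℝ) :
    euclNorm (v + w) ≤ euclNorm v + euclNorm w := by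
  simp only [euclNorm_eq_norm, WithLp.toLp_add]
  exact norm_add_le _ _

theorem euclNorm_smul {ι : Type*} [Fintype ι] (c : ℝ) (v : ι → ℝ) :
    euclNorm (c • v) = |c| * euclNorm v := by
  simp only [euclNorm_eq_norm, WithLp.toLp_smul, norm_smul, Real.norm_eq_abs]

theorem eq_zero_of_euclNorm_eq_zero {ι : Type*} [Fintype ι] {v : ι → ℝ}
    (h : euclNorm v = 0) : v = 0 := by
  rwa [euclNorm_eq_norm, norm_eq_zero, WithLp.toLp_eq_zero] at h

theorem abs_dotProduct_le_euclNorm {ι : Type*} [Fintype ι] (v w : ι → ℝ) :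
    |v ⬝ᵥ w| ≤ euclNorm v * euclNorm w := by
  apply abs_le_of_sq_le_sq _ (mul_nonneg (euclNorm_nonneg _) (euclNorm_nonneg _))
  rw [mul_pow, euclNorm_sq, euclNorm_sq]
  simpa [dotProduct, sq] using Finset.sum_mul_sq_le_sq_mul_sq Finset.univ v w

theorem euclNorm_mulVec_le_frobNorm {ι κ : Type*} [Fintype ι] [Fintype κ]
    (A : Matrix ι κ ℝ) (v : κ → ℝ) : euclNorm (A *ᵥ v) ≤ frobNorm A * euclNorm v := by
  refine le_of_sq_le_sq ?_ (mul_nonneg (Real.sqrt_nonneg _) (euclNorm_nonneg _))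
  rw [mul_pow, frobNorm, Real.sq_sqrt (by positivity), euclNorm, euclNorm,
    Real.sq_sqrt (by positivity), Real.sq_sqrt (by positivity), Finset.sum_mul]
  exact Finset.sum_le_sum fun i _ => Finset.sum_mul_sq_le_sq_mul_sq Finset.univ (A i) v

theorem euclNorm_mulVec_le_specNorm {ι κ : Type*} [Fintype ι] [Fintype κ]
    (A : Matrix ι κ ℝ) (v : κ → ℝ) : euclNorm (A *ᵥ v) ≤ specNorm A * euclNorm v := by
  rcases eq_or_ne (euclNorm v) 0 with h | h
  · rw [eq_zero_of_euclNorm_eq_zero h]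
    simp [euclNorm]
  · have hpos : 0 < euclNorm v := lt_of_le_of_ne (euclNorm_nonneg v) h.symm
    have hbdd : BddAbove {r : ℝ | ∃ w : κ → ℝ, euclNorm w = 1 ∧ r = euclNorm (A *ᵥ w)} := by
      refine ⟨frobNorm A, ?_⟩
      rintro r ⟨w, hw, rfl⟩
      simpa [hw] using euclNorm_mulVec_le_frobNorm A w
    have hle : euclNorm (A *ᵥ ((euclNorm v)⁻¹ • v)) ≤ specNorm A := by
      refine le_csSup hbdd ⟨_, ?_, rfl⟩
      rw [euclNorm_smul, abs_of_pos (inv_pos.2 hpos), inv_mul_cancel₀ h]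
    rw [Matrix.mulVec_smul, euclNorm_smul, abs_of_pos (inv_pos.2 hpos),
      inv_mul_le_iff₀ hpos] at hle
    linarith

theorem mulVec_dotProduct_mulVec {ι κ : Type*} [Fintype ι] [Fintype κ]
    (A : Matrix ι κ ℝ) (v w : κ → ℝ) : (A *ᵥ v) ⬝ᵥ (A *ᵥ w) = v ⬝ᵥ ((Aᵀ * A) *ᵥ w) := by
  rw [← Matrix.mulVec_mulVec, Matrix.dotProduct_mulVec v, Matrix.vecMul_transpose]

section Orthonormal

variable {m k : ℕ} {W : Matrix (Fin m) (Fin k) ℝ}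

theorem euclNorm_mulVec_of_orthonormal (hW : Wᵀ * W = 1) (v : Fin k → ℝ) :
    euclNorm (W *ᵥ v) = euclNorm v := by
  rw [← sq_eq_sq₀ (euclNorm_nonneg _) (euclNorm_nonneg _), euclNorm_sq, euclNorm_sq,
    mulVec_dotProduct_mulVec, hW, Matrix.one_mulVec]

theorem colProj_of_orthonormal (hW : Wᵀ * W = 1) : colProj W = W * Wᵀ := by
  simp [colProj, hW]

theorem euclNorm_sq_one_sub_colProj_mulVec (hW : Wᵀ * W = 1) (v : Fin m → ℝ) :
    euclNorm ((1 - colProj W) *ᵥ v) ^ 2 = euclNorm v ^ 2 - euclNorm (Wᵀ *ᵥ v) ^ 2 := by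
  have h : (1 - colProj W) *ᵥ v = v - W *ᵥ (Wᵀ *ᵥ v) := by
    rw [colProj_of_orthonormal hW, Matrix.sub_mulVec, Matrix.one_mulVec, Matrix.mulVec_mulVec]
  have h₁ : (W *ᵥ (Wᵀ *ᵥ v)) ⬝ᵥ (W *ᵥ (Wᵀ *ᵥ v)) = (Wᵀ *ᵥ v) ⬝ᵥ (Wᵀ *ᵥ v) := by
    rw [mulVec_dotProduct_mulVec, hW, Matrix.one_mulVec]
  have h₂ : v ⬝ᵥ (W *ᵥ (Wᵀ *ᵥ v)) = (Wᵀ *ᵥ v) ⬝ᵥ (Wᵀ *ᵥ v) := by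
    rw [Matrix.dotProduct_mulVec, ← Matrix.mulVec_transpose]
  rw [h, euclNorm_sq, euclNorm_sq, euclNorm_sq, dotProduct_sub, sub_dotProduct, sub_dotProduct,
    dotProduct_comm (W *ᵥ (Wᵀ *ᵥ v)) v, h₁, h₂]
  ring

theorem euclNorm_one_sub_colProj_mulVec_le (hW : Wᵀ * W = 1) (v : Fin m → ℝ) :
    euclNorm ((1 - colProj W) *ᵥ v) ≤ euclNorm v := by
  refine le_of_sq_le_sq ?_ (euclNorm_nonneg _)
  linarith [euclNorm_sq_one_sub_colProj_mulVec hW v, sq_nonneg (euclNorm (Wᵀ *ᵥ v))]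

theorem euclNorm_transpose_mulVec_le (hW : Wᵀ * W = 1) (v : Fin m → ℝ) :
    euclNorm (Wᵀ *ᵥ v) ≤ euclNorm v := by
  refine le_of_sq_le_sq ?_ (euclNorm_nonneg _)
  linarith [euclNorm_sq_one_sub_colProj_mulVec hW v,
    sq_nonneg (euclNorm ((1 - colProj W) *ᵥ v))]

theorem euclNorm_colProj_mulVec_le (hW : Wᵀ * W = 1) (v : Fin m → ℝ) :
    euclNorm (colProj W *ᵥ v) ≤ euclNorm v := by
  rw [colProj_of_orthonormal hW, ← Matrix.mulVec_mulVec, euclNorm_mulVec_of_orthonormal hW]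
  exact euclNorm_transpose_mulVec_le hW v

theorem abs_colProj_mulVec_apply_le (hW : Wᵀ * W = 1) (v : Fin m → ℝ) (i : Fin m) :
    |(colProj W *ᵥ v) i| ≤ euclNorm (W i) * euclNorm v := by
  rw [colProj_of_orthonormal hW, ← Matrix.mulVec_mulVec]
  exact (abs_dotProduct_le_euclNorm _ _).trans
    (mul_le_mul_of_nonneg_left (euclNorm_transpose_mulVec_le hW v) (euclNorm_nonneg _))

theorem euclNorm_row_sq_of_orthonormal (hW : Wᵀ * W = 1) (i : Fin m) :
    euclNorm (W i) ^ 2 = colProj W i i := by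
  rw [colProj_of_orthonormal hW, euclNorm_sq]
  rfl

theorem euclNorm_one_sub_colProj_mulVec_mulVec_le {k' : ℕ} {U : Matrix (Fin m) (Fin k') ℝ}
    (hU : Uᵀ * U = 1) (v : Fin k' → ℝ) :
    euclNorm ((1 - colProj W) *ᵥ (U *ᵥ v)) ≤ matDist W U * euclNorm v := by
  have h : colProj U *ᵥ (U *ᵥ v) = U *ᵥ v := by
    rw [colProj_of_orthonormal hU, Matrix.mulVec_mulVec, Matrix.mul_assoc, hU, Matrix.mul_one]
  rw [← euclNorm_mulVec_of_orthonormal hU v]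
  conv_lhs => rw [← h, Matrix.mulVec_mulVec]
  exact euclNorm_mulVec_le_specNorm _ _

end Orthonormal

section LowerBound

variable {m k : ℕ} {A : Matrix (Fin m) (Fin k) ℝ} {c : ℝ}

theorem isUnit_gram_of_lower_bound (hc : 0 < c)
    (hA : ∀ v, c * euclNorm v ≤ euclNorm (A *ᵥ v)) : IsUnit (Aᵀ * A) := by
  rw [← Matrix.mulVec_injective_iff_isUnit, ← Matrix.coe_mulVecLin, injective_iff_map_eq_zero]
  intro v hv
  rw [Matrix.mulVecLin_apply] at hv
  have h : euclNorm (A *ᵥ v) ^ 2 = 0 := by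
    rw [euclNorm_sq, mulVec_dotProduct_mulVec, hv, dotProduct_zero]
  have h₁ := hA v
  rw [pow_eq_zero_iff two_ne_zero] at h
  rw [h] at h₁
  exact eq_zero_of_euclNorm_eq_zero
    (le_antisymm (nonpos_of_mul_nonpos_right h₁ hc) (euclNorm_nonneg v))

theorem mul_sqrt_colProj_diag_le (hc : 0 < c)
    (hA : ∀ v, c * euclNorm v ≤ euclNorm (A *ᵥ v)) (i : Fin m) :
    c * Real.sqrt (colProj A i i) ≤ euclNorm (A i) := by
  have hG := (Matrix.isUnit_iff_isUnit_det _).1 (isUnit_gram_of_lower_bound hc hA)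
  set y := (Aᵀ * A)⁻¹ *ᵥ A i with hy
  have hGy : (Aᵀ * A) *ᵥ y = A i := by
    rw [hy, Matrix.mulVec_mulVec, Matrix.mul_nonsing_inv _ hG, Matrix.one_mulVec]
  have hdiag : colProj A i i = A i ⬝ᵥ y := by
    rw [colProj, Matrix.mul_assoc]
    rfl
  have hsq : colProj A i i = euclNorm (A *ᵥ y) ^ 2 := by
    rw [euclNorm_sq, mulVec_dotProduct_mulVec, hGy, hdiag, dotProduct_comm]
  rw [hsq, Real.sqrt_sq (euclNorm_nonneg _)]
  have h₁ := (le_abs_self _).trans (abs_dotProduct_le_euclNorm (A i) y)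
  rw [← hdiag, hsq] at h₁
  have h₂ := hA y
  rcases (euclNorm_nonneg (A *ᵥ y)).eq_or_lt with h | h
  · rw [← h, mul_zero]
    exact euclNorm_nonneg _
  · refine le_of_mul_le_mul_right ?_ h
    nlinarith [mul_le_mul_of_nonneg_left h₁ hc.le,
      mul_le_mul_of_nonneg_left h₂ (euclNorm_nonneg (A i))]

end LowerBound

theorem abs_clip_le {m k : ℕ} {θ : ℝ} (hθ : 0 ≤ θ) (W : Matrix (Fin m) (Fin k) ℝ)
    (i : Fin m) (j : Fin k) : |clip θ W i j| ≤ θ := by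
  unfold clip
  split_ifs with h
  · simpa using hθ
  · exact not_lt.1 h

theorem abs_clip_sub_le {m k : ℕ} {a : ℝ} {W E : Matrix (Fin m) (Fin k) ℝ} {i : Fin m}
    {j : Fin k} (h : |W i j - E i j| ≤ a) :
    |clip (2 * a) W i j - W i j| ≤ 2 * |E i j| := by
  unfold clip
  split_ifs with hc
  · rw [zero_sub, abs_neg]
    linarith [abs_sub_abs_le_abs_sub (W i j) (E i j)]
  · simp

theorem frobNorm_sq_le_of_col_le {m k : ℕ} {A : Matrix (Fin m) (Fin k) ℝ} {b : ℝ}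
    (h : ∀ j, euclNorm (A *ᵥ Pi.single j 1) ≤ b) : frobNorm A ^ 2 ≤ k * b ^ 2 := by
  rw [frobNorm, Real.sq_sqrt (by positivity), Finset.sum_comm]
  have hcol : ∀ j, ∑ i, A i j ^ 2 ≤ b ^ 2 := fun j => by
    have := pow_le_pow_left₀ (euclNorm_nonneg _) (h j) 2
    rw [euclNorm, Real.sq_sqrt (by positivity)] at this
    simpa using this
  simpa using Finset.sum_le_sum fun j (_ : j ∈ Finset.univ) => hcol j

theorem frobNorm_le_of_abs_le {m k : ℕ} {A B : Matrix (Fin m) (Fin k) ℝ} {c : ℝ} (hc : 0 ≤ c)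
    (h : ∀ i j, |A i j| ≤ c * |B i j|) : frobNorm A ≤ c * frobNorm B := by
  refine le_of_sq_le_sq ?_ (mul_nonneg hc (Real.sqrt_nonneg _))
  rw [mul_pow, frobNorm, frobNorm, Real.sq_sqrt (by positivity), Real.sq_sqrt (by positivity),
    Finset.mul_sum]
  refine Finset.sum_le_sum fun i _ => ?_
  rw [Finset.mul_sum]
  refine Finset.sum_le_sum fun j _ => ?_
  rw [← sq_abs (A i j), ← sq_abs (B i j), ← mul_pow]
  exact pow_le_pow_left₀ (abs_nonneg _) (h i j) 2

theorem euclNorm_le_sqrt_card_mul {k : ℕ} {v : Fin k → ℝ} {b : ℝ} (hb : 0 ≤ b)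
    (h : ∀ j, |v j| ≤ b) : euclNorm v ≤ Real.sqrt k * b := by
  refine le_of_sq_le_sq ?_ (by positivity)
  rw [mul_pow, Real.sq_sqrt (by positivity), euclNorm, Real.sq_sqrt (by positivity)]
  simpa using Finset.sum_le_sum fun j (_ : j ∈ Finset.univ) =>
    (sq_abs (v j)).symm.trans_le (pow_le_pow_left₀ (abs_nonneg _) (h j) 2)

/-- Clipping at twice the incoherence level `a` of `W` perturbs `U` by at most
`2 √k dist(W, U)` in Frobenius norm. -/
theorem frobNorm_clip_sub_le {m k l : ℕ} {W : Matrix (Fin m) (Fin l) ℝ}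
    {U : Matrix (Fin m) (Fin k) ℝ} (hW : Wᵀ * W = 1) (hU : Uᵀ * U = 1) {a δ : ℝ}
    (ha : ∀ i, euclNorm (W i) ≤ a) (hδ : 0 ≤ δ) (hdist : matDist W U ≤ δ) :
    frobNorm (clip (2 * a) U - U) ≤ 2 * (Real.sqrt k * δ) := by
  have hunit : ∀ j : Fin k, euclNorm (Pi.single j (1 : ℝ)) = 1 := fun j => by
    rw [← sq_eq_sq₀ (euclNorm_nonneg _) zero_le_one, euclNorm_sq]
    simp
  have hE : frobNorm ((1 - colProj W) * U) ≤ Real.sqrt k * δ := by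
    refine le_of_sq_le_sq ?_ (by positivity)
    rw [mul_pow, Real.sq_sqrt (by positivity)]
    refine frobNorm_sq_le_of_col_le fun j => ?_
    rw [← Matrix.mulVec_mulVec]
    refine (euclNorm_one_sub_colProj_mulVec_mulVec_le hU _).trans ?_
    rwa [hunit, mul_one]
  refine (frobNorm_le_of_abs_le (B := (1 - colProj W) * U) zero_le_two fun i j => ?_).trans
    (mul_le_mul_of_nonneg_left hE zero_le_two)
  refine abs_clip_sub_le ?_
  have h := abs_colProj_mulVec_apply_le hW (U *ᵥ Pi.single j 1) i
  rw [euclNorm_mulVec_of_orthonormal hU, hunit, mul_one, Matrix.mulVec_mulVec] at h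
  refine le_trans (le_of_eq ?_) (h.trans (ha i))
  rw [Matrix.sub_mul, Matrix.one_mul, Matrix.sub_apply, sub_sub_cancel]
  simp

/-- Lemma: clipping preserves closeness and yields incoherence:
if `U*` is `μ`-incoherent with orthonormal columns, `U` has orthonormal columns with
`dist(U, U*) ≤ 1/(64k)`, `U^c` is obtained from `U` by zeroing all entries of magnitude
greater than `2μ√k/√m`, and `Ũ` is an orthonormal basis of the column span of `U^c`, then
`dist(Ũ, U*) ≤ 1/2` and `Ũ` is incoherent with parameter `4μ√k`. -/
theorem clipping_incoherence
    (m k : ℕ) (hk : 0 < k) (μ : ℝ)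
    (Ustar U : Matrix (Fin m) (Fin k) ℝ)
    (hUstar : Ustarᵀ * Ustar = 1) (hU : Uᵀ * U = 1)
    -- `U*` is `μ`-incoherent
    (hinc : ∀ i, euclNorm (fun q => Ustar i q) ≤ μ * Real.sqrt k / Real.sqrt m)
    -- `dist(U, U*) = ‖(U*⊥)ᵀ U‖₂ ≤ 1/(64k)`
    (hdist : matDist Ustar U ≤ 1 / (64 * k))
    -- clipping
    (Uc : Matrix (Fin m) (Fin k) ℝ)
    (hUc : Uc = clip (2 * μ * Real.sqrt k / Real.sqrt m) U)
    -- `Ũ` is an orthonormal basis of the column span of `U^c`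
    (Util : Matrix (Fin m) (Fin k) ℝ)
    (hUtil : Utilᵀ * Util = 1) (hspan : colProj Util = colProj Uc) :
    matDist Ustar Util ≤ 1 / 2 ∧
      ∀ i, euclNorm (fun q => Util i q) ≤ (4 * μ * Real.sqrt k) * Real.sqrt k / Real.sqrt m := by
  obtain ⟨a, ha⟩ : ∃ a, a = μ * Real.sqrt k / Real.sqrt m := ⟨_, rfl⟩
  have hθ : 2 * μ * Real.sqrt k / Real.sqrt m = 2 * a := by rw [ha]; ring
  rw [← ha] at hinc
  have hk1 : (1 : ℝ) ≤ k := by exact_mod_cast hk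
  have hδ : (1 : ℝ) / (64 * k) ≤ 1 / 64 :=
    one_div_le_one_div_of_le (by norm_num) (by linarith)
  have hsqrt : Real.sqrt k * (1 / (64 * k)) ≤ 1 / 64 := by
    have h : Real.sqrt k ≤ k := Real.sqrt_le_iff.2 ⟨by linarith, by nlinarith⟩
    rw [mul_one_div, div_le_iff₀ (by positivity)]
    linarith
  have hF : frobNorm (Uc - U) ≤ 1 / 32 := by
    rw [hUc, hθ]
    refine (frobNorm_clip_sub_le hUstar hU hinc (by positivity) hdist).trans ?_
    linarith
  have hpert : ∀ v, euclNorm ((Uc - U) *ᵥ v) ≤ 1 / 32 * euclNorm v := fun v =>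
    (euclNorm_mulVec_le_frobNorm _ v).trans
      (mul_le_mul_of_nonneg_right hF (euclNorm_nonneg v))
  have hlow : ∀ v, 31 / 32 * euclNorm v ≤ euclNorm (Uc *ᵥ v) := fun v => by
    have h : U *ᵥ v = Uc *ᵥ v + (-1 : ℝ) • ((Uc - U) *ᵥ v) := by
      rw [Matrix.sub_mulVec]
      module
    have h₁ := euclNorm_add_le (Uc *ᵥ v) ((-1 : ℝ) • ((Uc - U) *ᵥ v))
    rw [← h, euclNorm_smul, euclNorm_mulVec_of_orthonormal hU, abs_neg, abs_one, one_mul] at h₁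
    linarith [hpert v]
  constructor
  · refine Real.sSup_le ?_ (by norm_num)
    rintro r ⟨v, hv, rfl⟩
    obtain ⟨y, hy⟩ : ∃ y, colProj Util *ᵥ v = Uc *ᵥ y :=
      ⟨((Uc.transpose * Uc)⁻¹ * Uc.transpose) *ᵥ v, by
        rw [hspan, colProj, Matrix.mulVec_mulVec, Matrix.mul_assoc]⟩
    have hy1 : 31 / 32 * euclNorm y ≤ 1 := by
      rw [← hv]
      exact (hlow y).trans (hy ▸ euclNorm_colProj_mulVec_le hUtil v)
    have hsplit : Uc *ᵥ y = U *ᵥ y + (Uc - U) *ᵥ y := by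
      rw [Matrix.sub_mulVec]
      abel
    rw [← Matrix.mulVec_mulVec, hy, hsplit, Matrix.mulVec_add]
    have h₁ := euclNorm_one_sub_colProj_mulVec_mulVec_le (W := Ustar) hU y
    have h₂ := mul_le_mul_of_nonneg_right (hdist.trans hδ) (euclNorm_nonneg y)
    have h₃ := euclNorm_one_sub_colProj_mulVec_le hUstar ((Uc - U) *ᵥ y)
    refine (euclNorm_add_le _ _).trans ?_
    linarith [hpert y]
  · intro i
    have ha0 : 0 ≤ a := (euclNorm_nonneg _).trans (hinc i)
    have hrow : euclNorm (Uc i) ≤ Real.sqrt k * (2 * a) := by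
      rw [hUc, hθ]
      exact euclNorm_le_sqrt_card_mul (by positivity) (abs_clip_le (by positivity) U i)
    have h := mul_sqrt_colProj_diag_le (by norm_num) hlow i
    rw [← hspan, ← euclNorm_row_sq_of_orthonormal hUtil,
      Real.sqrt_sq (euclNorm_nonneg _)] at h
    have hgoal : 4 * μ * Real.sqrt k * Real.sqrt k / Real.sqrt m = 4 * (Real.sqrt k * a) := by
      rw [ha]
      ring
    rw [hgoal]
    have hnn : 0 ≤ Real.sqrt k * a := by positivity
    change euclNorm (Util i) ≤ _
    linarith

end AltMin
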